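/- arXiv:2408.12771 — 3 statements merged into one kernel-verified Lean document; each statement's English description precedes it below -/
import Mathlib

section
/- Let w > 0, d ∈ ℝ with d ≠ 1/w², and let αᵢ, βᵢ, γᵢ (i = 1,…,5) be real numbers with β₁ = γ₁·w², β₂ = w²γ₂ − α₁γ₁, γ₁ ≠ 0, 1 − 5w² + w⁴ + 3dw² − 3dw⁴ + 3dw⁶ ≠ 0, and η > 0, where η = (1 − dw²)(w²γ₁³d − w⁴γ₁³d² − w²γ₃ + α₁γ₂ + α₂γ₁ + β₃) / (γ₁(1 − 5w² + w⁴ + 3dw² − 3dw⁴ + 3dw⁶)). For ε ∈ ℝ define a(ε) = −w² + Σᵢ₌₁⁵ εⁱαᵢ, b(ε) = Σᵢ₌₁⁵ εⁱβᵢ, c(ε) = Σᵢ₌₁⁵ εⁱγᵢ. Then for every δ > 0 there exists ε₀ > 0 such that for all ε with 0 < |ε| < ε₀, the FitzHugh–Nagumo system ẋ = z, ẏ = b(ε)(x − d y), ż = (x − a(ε))(x − 1)x + y + c(ε) z admits a nonconstant periodic solution φ : ℝ → ℝ³ (differentiable, satisfying the system at every time, and T-periodic for some T > 0) whose image is contained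 in the open ball of radius δ centered at the origin. -/
namespace FHN
open Set Filter Topology

instance twoPiPos : Fact (0 < 2 * Real.pi) := ⟨Real.two_pi_pos⟩

abbrev Cir := AddCircle (2 * Real.pi)
abbrev E := C(Cir, ℝ)

/-- `k` is the derivative of `h`. -/
def Der (h k : E) : Prop := ∀ t : ℝ, HasDerivAt (fun s : ℝ => h (s : Cir)) (k (t : Cir)) t

lemma cont_coe (f : E) : Continuous (fun s : ℝ => f (s : Cir)) :=
  f.continuous.comp (AddCircle.continuous_mk' _)

lemma Der.add {h k h' k' : E} (a : Der h k) (b : Der h' k') : Der (h + h') (k + k') :=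
  fun t => (a t).add (b t)
lemma Der.sub {h k h' k' : E} (a : Der h k) (b : Der h' k') : Der (h - h') (k - k') :=
  fun t => (a t).sub (b t)
lemma Der.mul {h k h' k' : E} (a : Der h k) (b : Der h' k') : Der (h * h') (k * h' + h * k') :=
  fun t => (a t).mul (b t)
lemma Der.smul {h k : E} (c : ℝ) (a : Der h k) : Der (c • h) (c • k) :=
  fun t => (a t).const_mul c
lemma Der.one : Der 1 0 := fun t => hasDerivAt_const t 1
lemma Der.congr {h k k' : E} (a : Der h k) (e : k = k') : Der h k' := e ▸ a

noncomputable def m : E →L[ℝ] ℝ :=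
  LinearMap.mkContinuous
    { toFun := fun f => (2 * Real.pi)⁻¹ * ∫ t in (0:ℝ)..(2 * Real.pi), f (t : Cir)
      map_add' := fun f g => by
        simp only [ContinuousMap.add_apply]
        rw [intervalIntegral.integral_add ((cont_coe f).intervalIntegrable _ _)
          ((cont_coe g).intervalIntegrable _ _)]
        ring
      map_smul' := fun c f => by
        simp only [ContinuousMap.smul_apply, smul_eq_mul, RingHom.id_apply]
        rw [intervalIntegral.integral_const_mul]
        ring } 1 (fun f => by
    have h := intervalIntegral.norm_integral_le_of_norm_le_const (a := 0) (b := 2 * Real.pi)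
      (f := fun t : ℝ => f (t : Cir)) (C := ‖f‖) (fun t _ => f.norm_coe_le_norm _)
    have hp := Real.two_pi_pos
    simp only [LinearMap.coe_mk, AddHom.coe_mk, norm_mul, one_mul]
    rw [sub_zero, abs_of_pos hp] at h
    rw [norm_inv, Real.norm_of_nonneg hp.le, inv_mul_le_iff₀ hp]
    linarith)

lemma m_apply (f : E) : m f = (2 * Real.pi)⁻¹ * ∫ t in (0:ℝ)..(2 * Real.pi), f (t : Cir) := rfl

lemma m_one : m 1 = 1 := by
  have hp := Real.pi_ne_zero
  rw [m_apply]; simp; field_simp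

lemma coe_two_pi : (((2 * Real.pi : ℝ)) : Cir) = ((0:ℝ) : Cir) := by
  rw [AddCircle.coe_period]; simp

lemma Der.mean {h k : E} (a : Der h k) : m k = 0 := by
  rw [m_apply, intervalIntegral.integral_eq_sub_of_hasDerivAt (fun t _ => a t)
    ((cont_coe k).intervalIntegrable _ _), coe_two_pi]
  simp

noncomputable def J0fun (f : E) (t : ℝ) : ℝ := ∫ s in (0:ℝ)..t, (f (s : Cir) - m f)

lemma J0_deriv (f : E) (t : ℝ) : HasDerivAt (J0fun f) (f (t : Cir) - m f) t := by
  have hc : Continuous (fun s : ℝ => f (s : Cir) - m f) := (cont_coe f).sub continuous_const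
  exact hc.integral_hasStrictDerivAt 0 t |>.hasDerivAt

lemma J0_int (f : E) (a b : ℝ) : IntervalIntegrable (fun s : ℝ => f (s : Cir) - m f)
    MeasureTheory.volume a b := ((cont_coe f).sub continuous_const).intervalIntegrable _ _

lemma J0_per (f : E) : Function.Periodic (J0fun f) (2 * Real.pi) := by
  intro t
  have hp := Real.two_pi_pos
  have hper : Function.Periodic (fun s : ℝ => f (s : Cir) - m f) (2 * Real.pi) := by
    intro s; simp
  have hz : ∫ s in (0:ℝ)..(2 * Real.pi), (f (s : Cir) - m f) = 0 := by
    rw [intervalIntegral.integral_sub ((cont_coe f).intervalIntegrable _ _)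
      (continuous_const.intervalIntegrable _ _), m_apply, intervalIntegral.integral_const]
    have hpi := Real.pi_ne_zero
    generalize (∫ t in (0:ℝ)..(2 * Real.pi), f (t : Cir)) = I
    simp only [smul_eq_mul, sub_zero]
    field_simp
    ring
  unfold J0fun
  rw [← intervalIntegral.integral_add_adjacent_intervals (J0_int f 0 t) (J0_int f t _),
    hper.intervalIntegral_add_eq t 0, zero_add, hz, add_zero]

lemma J0_cont (f : E) : Continuous (J0fun f) :=
  continuous_iff_continuousAt.2 fun t => (J0_deriv f t).continuousAt

noncomputable def J0 (f : E) : E :=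
  ⟨(J0_per f).lift, by
    exact continuous_coinduced_dom.mpr (J0_cont f)⟩

lemma J0_apply (f : E) (t : ℝ) : J0 f (t : Cir) = J0fun f t := rfl

lemma coe_ext {f g : E} (h : ∀ t : ℝ, f (t : Cir) = g (t : Cir)) : f = g := by
  ext x
  induction x using QuotientAddGroup.induction_on with
  | H z => exact h z

lemma m_le (f : E) : |m f| ≤ ‖f‖ := by
  have := m.le_of_opNorm_le (LinearMap.mkContinuous_norm_le _ zero_le_one _) f
  simpa using this

noncomputable def J1 : E →L[ℝ] E :=
  LinearMap.mkContinuous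
    { toFun := J0
      map_add' := fun f g => by
        apply coe_ext; intro t
        simp only [ContinuousMap.add_apply, J0_apply, J0fun]
        rw [← intervalIntegral.integral_add (J0_int _ _ _) (J0_int _ _ _)]
        congr 1; ext s
        simp; ring
      map_smul' := fun c f => by
        apply coe_ext; intro t
        simp only [ContinuousMap.smul_apply, J0_apply, J0fun, smul_eq_mul, RingHom.id_apply]
        rw [← intervalIntegral.integral_const_mul]
        congr 1; ext s
        simp; ring } (2 * (2 * Real.pi)) (fun f => by
    have hp := Real.two_pi_pos
    rw [ContinuousMap.norm_le _ (by positivity)]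
    intro x
    obtain ⟨t, ht, rfl⟩ : ∃ t ∈ Ico (0:ℝ) (0 + 2 * Real.pi), (t : Cir) = x := by
      have := AddCircle.coe_image_Ico_eq (2 * Real.pi) 0
      have hx : x ∈ (QuotientAddGroup.mk '' Ico (0:ℝ) (0 + 2 * Real.pi) : Set Cir) := by
        rw [this]; trivial
      exact hx
    have h := intervalIntegral.norm_integral_le_of_norm_le_const (a := 0) (b := t)
      (f := fun s : ℝ => f (s : Cir) - m f) (C := 2 * ‖f‖) (fun s _ => by
        refine (norm_sub_le _ _).trans ?_
        have := m_le f
        have := f.norm_coe_le_norm (s : Cir)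
        simp only [Real.norm_eq_abs] at *
        linarith)
    refine (show ‖J0fun f t‖ ≤ _ from h).trans ?_
    rw [sub_zero, abs_of_nonneg ht.1]
    have := ht.2
    have := norm_nonneg f
    nlinarith)

lemma J1_apply (f : E) : J1 f = J0 f := rfl

lemma J1_der (f : E) : Der (J1 f) (f - m f • 1) := by
  intro t
  have := J0_deriv f t
  simpa [J1_apply, J0_apply] using this

noncomputable def J : E →L[ℝ] E := J1 - (m.comp J1).smulRight (1 : E)

lemma J_der (f : E) : Der (J f) (f - m f • 1) := by
  have := (J1_der f).sub (Der.one.smul (m (J1 f)))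
  simpa [J] using this

lemma J_mean (f : E) : m (J f) = 0 := by
  simp [J, m_one]

noncomputable def c1 : E := ⟨Real.Angle.cos, Real.Angle.continuous_cos⟩
noncomputable def s1 : E := ⟨Real.Angle.sin, Real.Angle.continuous_sin⟩

lemma c1_apply (t : ℝ) : c1 (t : Cir) = Real.cos t := rfl
lemma s1_apply (t : ℝ) : s1 (t : Cir) = Real.sin t := rfl

lemma c1_der : Der c1 (-s1) := fun t => by
  simpa [c1_apply, s1_apply] using Real.hasDerivAt_cos t
lemma s1_der : Der s1 c1 := fun t => by
  simpa [c1_apply, s1_apply] using Real.hasDerivAt_sin t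

lemma cs : c1 * c1 + s1 * s1 = 1 := by
  apply coe_ext; intro t
  simp only [ContinuousMap.add_apply, ContinuousMap.mul_apply, c1_apply, s1_apply,
    ContinuousMap.one_apply]
  nlinarith [Real.sin_sq_add_cos_sq t]

/-- uniqueness -/
lemma Der.uniq {h h' k : E} (a : Der h k) (b : Der h' k) (e : m h = m h') : h = h' := by
  have hd : ∀ t : ℝ, HasDerivAt (fun s : ℝ => (h - h') (s : Cir)) 0 t := fun t => by
    simpa using (a.sub b) t
  have hc : ∀ t : ℝ, (h - h') (t : Cir) = (h - h') ((0 : ℝ) : Cir) := fun t =>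
    is_const_of_deriv_eq_zero (fun t => (hd t).differentiableAt) (fun t => (hd t).deriv) t 0
  have h1 : h - h' = ((h - h') ((0 : ℝ) : Cir)) • (1 : E) := by
    apply coe_ext; intro t
    rw [hc t]; simp
  have h2 : m (h - h') = 0 := by rw [map_sub, e, sub_self]
  rw [h1, map_smul, m_one] at h2
  simp only [smul_eq_mul, mul_one] at h2
  rw [h2, zero_smul] at h1
  exact sub_eq_zero.1 h1


lemma m_c1 : m c1 = 0 := s1_der.mean
lemma m_s1 : m s1 = 0 := by
  have := c1_der.mean
  simpa using this
lemma m_cs : m (c1 * s1) = 0 := by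
  have h := (s1_der.mul s1_der).mean
  have e : c1 * s1 + s1 * c1 = (2:ℝ) • (c1 * s1) := by
    ext x; simp; ring
  rw [e, map_smul, smul_eq_mul] at h
  linarith
lemma m_ss_cc : m (c1 * c1) = m (s1 * s1) := by
  have h := (s1_der.mul c1_der).mean
  have e : c1 * c1 + s1 * -s1 = c1 * c1 - s1 * s1 := by ring
  rw [e, map_sub] at h
  linarith
lemma m_cc : m (c1 * c1) = 1 / 2 := by
  have h := congrArg m cs
  rw [map_add, m_one, ← m_ss_cc] at h
  linarith
lemma m_ss : m (s1 * s1) = 1 / 2 := by rw [← m_ss_cc, m_cc]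

noncomputable def mulL (g : E) : E →L[ℝ] E := ContinuousLinearMap.mul ℝ E g
lemma mulL_apply (g f : E) : mulL g f = g * f := rfl

noncomputable def G : E →L[ℝ] E :=
  (mulL s1).comp (J.comp (mulL c1)) - (mulL c1).comp (J.comp (mulL s1))
noncomputable def G' : E →L[ℝ] E :=
  (mulL c1).comp (J.comp (mulL c1)) + (mulL s1).comp (J.comp (mulL s1))
lemma G_apply (f : E) : G f = s1 * J (c1 * f) - c1 * J (s1 * f) := rfl
lemma G'_apply (f : E) : G' f = c1 * J (c1 * f) + s1 * J (s1 * f) := rfl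

lemma J_der0 {f : E} (h : m f = 0) : Der (J f) f := by
  have := J_der f
  rwa [h, zero_smul, sub_zero] at this

lemma cs_pt (x : Cir) : c1 x * c1 x + s1 x * s1 x = 1 := by
  have := congrArg (fun f : E => f x) cs
  simpa using this

lemma G_der {f : E} (hc : m (c1 * f) = 0) (hs : m (s1 * f) = 0) : Der (G f) (G' f) := by
  refine ((s1_der.mul (J_der0 hc)).sub (c1_der.mul (J_der0 hs))).congr ?_
  rw [G'_apply]; ring

lemma G'_der {f : E} (hc : m (c1 * f) = 0) (hs : m (s1 * f) = 0) : Der (G' f) (f - G f) := by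
  refine ((c1_der.mul (J_der0 hc)).add (s1_der.mul (J_der0 hs))).congr ?_
  rw [G_apply]
  linear_combination f * cs

lemma G_c1 {f : E} (hc : m (c1 * f) = 0) (hs : m (s1 * f) = 0) : m (G f * c1) = 0 := by
  have h1 := ((s1_der.mul s1_der).mul (J_der0 hc)).mean
  have h2 := ((s1_der.mul c1_der).mul (J_der0 hs)).mean
  have e : (2:ℝ) • (G f * c1) =
     ((c1 * s1 + s1 * c1) * J (c1 * f) + s1 * s1 * (c1 * f)) -
     ((c1 * c1 + s1 * -s1) * J (s1 * f) + s1 * c1 * (s1 * f)) - J (s1 * f) := by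
    rw [G_apply, two_smul]
    linear_combination (-J (s1 * f)) * cs
  have := congrArg m e
  rw [map_sub, map_sub, h1, h2, J_mean, map_smul, smul_eq_mul] at this
  linarith

lemma G_s1 {f : E} (hc : m (c1 * f) = 0) (hs : m (s1 * f) = 0) : m (G f * s1) = 0 := by
  have h1 := ((s1_der.mul c1_der).mul (J_der0 hc)).mean
  have h2 := ((c1_der.mul c1_der).mul (J_der0 hs)).mean
  have e : (2:ℝ) • (G f * s1) = - ((c1 * c1 + s1 * -s1) * J (c1 * f) + s1 * c1 * (c1 * f)) +
     ((-s1 * c1 + c1 * -s1) * J (s1 * f) + c1 * c1 * (s1 * f)) + J (c1 * f) := by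
    rw [G_apply, two_smul]
    linear_combination (J (c1 * f)) * cs
  have := congrArg m e
  rw [map_add, map_add, map_neg, h1, h2, J_mean, map_smul, smul_eq_mul] at this
  linarith

lemma G_mean {f : E} (h : m f = 0) (hc : m (c1 * f) = 0) (hs : m (s1 * f) = 0) :
    m (G f) = 0 := by
  have := (G'_der hc hs).mean
  rw [map_sub] at this
  linarith

lemma G'_s1 {f : E} (hc : m (c1 * f) = 0) (hs : m (s1 * f) = 0) : m (G' f * s1) = 0 := by
  have := ((G_der hc hs).mul s1_der).mean
  rw [map_add, G_c1 hc hs] at this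
  linarith

noncomputable def Pr (f : E) : E := f - m f • 1 - (2 * m (f * c1)) • c1 - (2 * m (f * s1)) • s1

lemma Pr_mean (f : E) : m (Pr f) = 0 := by
  simp [Pr, m_one, m_c1, m_s1]
lemma Pr_c1 (f : E) : m (c1 * Pr f) = 0 := by
  have : c1 * Pr f = f * c1 - m f • c1 - (2 * m (f * c1)) • (c1 * c1) -
    (2 * m (f * s1)) • (c1 * s1) := by
    ext x; simp [Pr]; ring
  rw [this]
  simp [m_cc, m_cs, m_c1]
  ring
lemma Pr_s1 (f : E) : m (s1 * Pr f) = 0 := by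
  have : s1 * Pr f = f * s1 - m f • s1 - (2 * m (f * c1)) • (c1 * s1) -
    (2 * m (f * s1)) • (s1 * s1) := by
    ext x; simp [Pr]; ring
  rw [this]
  simp [m_ss, m_cs, m_s1]
  ring

lemma m_ccc : m (c1 * c1 * c1) = 0 := by
  have h := (((s1_der.mul s1_der).mul s1_der)).mean
  have e : (c1 * s1 + s1 * c1) * s1 + s1 * s1 * c1 = (3:ℝ) • c1 - (3:ℝ) • (c1 * c1 * c1) := by
    ext x
    simp
    linear_combination 3 * c1 x * cs_pt x
  rw [e, map_sub, map_smul, map_smul, m_c1] at h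
  simp at h
  linarith

section key
variable {ε r d v κ ω a B C N : ℝ} {p f M X X1 V : E}

lemma key (hε : ε ≠ 0) (hr : r ≠ 0) (hω : ω ≠ 0) (hω2 : ω ^ 2 = ε ^ 2 * κ - a)
  (hM : M = (d * v) • 1 + G f) (hX : X = r • c1 + ε • M) (hX1 : X1 = -(r • s1) + ε • G' f)
  (hV : V = v • 1 + J p)
  (hp : p = (B / ω) • (r • c1 + ε • G f - (d * ε) • J p))
  (hv : (1 + a * d) * v = (1 + a) * m (X * X) - ε * m (X * X * X))
  (hf : f = (ω ^ 2)⁻¹ • Pr ((ε * κ) • X + J p + (C * ω) • X1 - (1 + a) • (X * X)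
      + ε • (X * X * X)))
  (hκ : κ * r = -(B / ω) * d * (2 * m (J p * s1)) + (1 + a) * (2 * m (((2 * r) • (c1 * M)
      + ε • (M * M)) * c1)) - 2 * m (X * X * X * c1))
  (hN : a * C + B = ε ^ 2 * N)
  (hg : r ^ 2 / 2 * (κ * C - N) + ω ^ 2 * C * m (G' f * G' f) - B * m (G f * G f)
      + d ^ 2 * B * m (J p * J p) = 0) :
  Der X X1 ∧ Der V p ∧ m (X * c1) = r / 2 ∧ ω • p = B • (X - (d * ε) • V) ∧
  ∃ X2, Der X1 X2 ∧ ω ^ 2 • X2 = a • X + ε • V + (ε * C * ω) • X1 - (ε * (1 + a)) • (X * X)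
    + ε ^ 2 • (X * X * X) := by
  have fm : m f = 0 := by rw [hf, map_smul, Pr_mean, smul_zero]
  have fc : m (c1 * f) = 0 := by rw [hf, mul_smul_comm, map_smul, Pr_c1, smul_zero]
  have fs : m (s1 * f) = 0 := by rw [hf, mul_smul_comm, map_smul, Pr_s1, smul_zero]
  have pm : m p = 0 := by
    rw [hp]; simp [m_c1, G_mean fm fc fs, J_mean]
  have gc := G_c1 fc fs
  have gs := G_s1 fc fs
  have gm := G_mean fm fc fs
  have g's := G'_s1 fc fs
  have dG := G_der fc fs
  have dG' := G'_der fc fs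
  have dJ := J_der0 pm
  have jm := J_mean p
  have dX : Der X X1 := by
    rw [hX, hM]
    refine ((c1_der.smul r).add (((Der.one.smul (d * v)).add dG).smul ε)).congr ?_
    rw [hX1]; simp
  have dV : Der V p := by
    rw [hV]
    refine ((Der.one.smul v).add dJ).congr ?_
    simp
  set X2 : E := -(r • c1) + ε • (f - G f) with hX2
  have dX1 : Der X1 X2 := by
    rw [hX1]
    have h := ((s1_der.smul (-r)).add (dG'.smul ε))
    simpa using h
  have ep : ω • p = B • (X - (d * ε) • V) := by
    conv_lhs => rw [hp]
    rw [hX, hM, hV]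
    ext x
    simp
    field_simp
    ring
  have Xc : m (X * c1) = r / 2 := by
    have : X * c1 = r • (c1 * c1) + (ε * (d * v)) • c1 + ε • (G f * c1) := by
      rw [hX, hM]; ext x; simp; ring
    rw [this]
    simp [m_cc, m_c1, gc]
    ring
  have Xs : m (X * s1) = 0 := by
    have : X * s1 = r • (c1 * s1) + (ε * (d * v)) • s1 + ε • (G f * s1) := by
      rw [hX, hM]; ext x; simp; ring
    rw [this]
    simp [m_cs, m_s1, gs]
  have Xm : m X = ε * (d * v) := by
    rw [hX, hM]; simp [m_c1, m_one, gm]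
  have X1m : m X1 = 0 := dX.mean
  have X1c : m (X1 * c1) = 0 := by
    have := (dX.mul c1_der).mean
    simp [Xs] at this
    exact this
  have X1s : m (X1 * s1) = - (r / 2) := by
    have := (dX.mul s1_der).mean
    simp [Xc] at this
    linarith
  set H : E := (ε * κ) • X + V + (C * ω) • X1 - (1 + a) • (X * X) + ε • (X * X * X) with hH
  have Hm : m H = ω ^ 2 * (d * v) := by
    rw [hH, hV]
    simp [Xm, X1m, m_one, jm]
    rw [hω2]
    linear_combination hv
  have Jc : m (J p * c1) = (B / ω) * d * ε * m (J p * s1) := by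
    have h1 := (dJ.mul s1_der).mean
    have h2 : p * s1 = (B / ω) • (r • (c1 * s1) + ε • (G f * s1) - (d * ε) • (J p * s1)) := by
      conv_lhs => rw [hp]
      ext x; simp; left; ring
    rw [map_add, h2] at h1
    simp [m_cs, gs] at h1
    linarith
  have XXc : m (X * X * c1) = ε * m (((2 * r) • (c1 * M) + ε • (M * M)) * c1) := by
    have : X * X * c1 = r ^ 2 • (c1 * c1 * c1) + ε • (((2 * r) • (c1 * M) + ε • (M * M)) * c1) := by
      rw [hX]; ext x; simp; ring
    rw [this, map_add, map_smul, map_smul, m_ccc]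
    simp
  have Hc : m (H * c1) = 0 := by
    have : H * c1 = (ε * κ) • (X * c1) + v • c1 + J p * c1 + (C * ω) • (X1 * c1)
      - (1 + a) • (X * X * c1) + ε • (X * X * X * c1) := by
      rw [hH, hV]; ext x; simp; ring
    rw [this]
    simp only [map_add, map_sub, map_smul, Xc, m_c1, Jc, X1c, XXc, smul_eq_mul]
    linear_combination ε / 2 * hκ
  have PrH : ω ^ 2 • f = Pr H := by
    have : Pr ((ε * κ) • X + J p + (C * ω) • X1 - (1 + a) • (X * X)
      + ε • (X * X * X)) = Pr H := by
      have e : H = ((ε * κ) • X + J p + (C * ω) • X1 - (1 + a) • (X * X)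
        + ε • (X * X * X)) + v • 1 := by
        rw [hH, hV]; ext x; simp; ring
      rw [e]
      generalize ((ε * κ) • X + J p + (C * ω) • X1 - (1 + a) • (X * X)
        + ε • (X * X * X)) = Q
      unfold Pr
      simp [add_mul, m_one, m_c1, m_s1]
      module
    conv_lhs => rw [hf]
    rw [this, smul_smul, mul_inv_cancel₀ (pow_ne_zero 2 hω), one_smul]
  -- residual
  have Hres : H = ω ^ 2 • f + (ω ^ 2 * (d * v)) • 1 + (2 * m (H * s1)) • s1 := by
    rw [PrH, Pr, Hm, Hc]
    ext x; simp; ring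
  have XX1 : m (X * X1) = 0 := by
    have h := (dX.mul dX).mean
    rw [map_add, mul_comm X1 X] at h
    linarith
  have XXX1 : m (X * X * X1) = 0 := by
    have h := ((dX.mul dX).mul dX).mean
    have e : (X1 * X + X * X1) * X + X * X * X1 = (3:ℝ) • (X * X * X1) := by
      ext x; simp; ring
    rw [e, map_smul, smul_eq_mul] at h
    linarith
  have XXXX1 : m (X * X * X * X1) = 0 := by
    have h := (((dX.mul dX).mul dX).mul dX).mean
    have e : ((X1 * X + X * X1) * X + X * X * X1) * X + X * X * X * X1
       = (4:ℝ) • (X * X * X * X1) := by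
      ext x; simp; ring
    rw [e, map_smul, smul_eq_mul] at h
    linarith
  have X2X1 : m (X1 * X2) = 0 := by
    have h := (dX1.mul dX1).mean
    rw [map_add, mul_comm X2 X1] at h
    linarith
  have e2 : ε • (f + (d * v) • 1) = X + X2 := by
    rw [hX2, hX, hM]; ext x; simp; ring
  have fX1 : m ((f + (d * v) • 1) * X1) = 0 := by
    have h : ε * m ((f + (d * v) • 1) * X1) = 0 := by
      rw [← smul_eq_mul, ← map_smul, ← smul_mul_assoc, e2, add_mul, map_add, XX1, mul_comm X2 X1,
        X2X1, add_zero]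
    exact (mul_eq_zero.1 h).resolve_left hε
  -- energy
  set Xt : E := r • c1 + ε • G f with hXt
  have hp' : ω • p = B • (Xt - (d * ε) • J p) := by
    conv_lhs => rw [hp]
    rw [smul_smul, mul_div_cancel₀ _ hω]
  have eX : X = Xt + (ε * (d * v)) • 1 := by
    rw [hXt, hX, hM]; ext x; simp; ring
  have Jpp : m (p * J p) = 0 := by
    have h := (dJ.mul dJ).mean
    rw [map_add, mul_comm (J p) p] at h
    linarith
  have BJX : B * m (Xt * J p) = B * (d * ε) * m (J p * J p) := by
    have h : (ω • p) * J p = (B • (Xt - (d * ε) • J p)) * J p := by rw [hp']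
    have h' := congrArg m h
    have e : (B • (Xt - (d * ε) • J p)) * J p = B • (Xt * J p) - (B * (d * ε)) • (J p * J p) := by
      ext x; simp; ring
    rw [e, smul_mul_assoc, map_smul, Jpp, map_sub, map_smul, map_smul] at h'
    simp only [smul_eq_mul] at h'
    linarith
  have VX1 : ω * m (V * X1) = - (B * m (Xt * Xt)) + d ^ 2 * ε ^ 2 * B * m (J p * J p) := by
    have h := (dV.mul dX).mean
    rw [map_add] at h
    have h2 : ω • (p * X) = B • (Xt * Xt) - (d * ε * B) • (Xt * J p)
        + (ω * (ε * (d * v))) • p := by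
      rw [eX, ← smul_mul_assoc, mul_add, hp']
      have e : B • (Xt - (d * ε) • J p) * (ε * (d * v)) • (1:E) = (ω * (ε * (d * v))) • p := by
        rw [← hp']; ext x; simp; ring
      rw [e]
      ext x; simp; ring
    have h3 := congrArg m h2
    simp only [map_add, map_sub, map_smul, smul_eq_mul, pm] at h3
    linear_combination ω * h - h3 + (d * ε) * BJX
  have XtXt : m (Xt * Xt) = r ^ 2 / 2 + ε ^ 2 * m (G f * G f) := by
    have : Xt * Xt = r ^ 2 • (c1 * c1) + (2 * r * ε) • (G f * c1) + ε ^ 2 • (G f * G f) := by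
      rw [hXt]; ext x; simp; ring
    rw [this]
    simp only [map_add, map_smul, smul_eq_mul, m_cc, gc]
    ring
  have X1X1 : m (X1 * X1) = r ^ 2 / 2 + ε ^ 2 * m (G' f * G' f) := by
    have : X1 * X1 = r ^ 2 • (s1 * s1) + (-2 * r * ε) • (G' f * s1) + ε ^ 2 • (G' f * G' f) := by
      rw [hX1]; ext x; simp; ring
    rw [this]
    simp only [map_add, map_smul, smul_eq_mul, m_ss, g's]
    ring
  have hen : m (V * X1) + C * ω * m (X1 * X1) = 0 := by
    have : ω * (m (V * X1) + C * ω * m (X1 * X1)) = 0 := by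
      rw [mul_add, VX1, XtXt, X1X1]
      linear_combination ε ^ 2 * hg + (r ^ 2 / 2 * C) * hω2 - r ^ 2 / 2 * hN
    exact (mul_eq_zero.1 this).resolve_left hω
  have s0 : m (H * s1) = 0 := by
    have h1 : m (H * X1) = 0 := by
      have : H * X1 = (ε * κ) • (X * X1) + V * X1 + (C * ω) • (X1 * X1)
        - (1 + a) • (X * X * X1) + ε • (X * X * X * X1) := by
        rw [hH]; ext x; simp; ring
      rw [this]
      simp only [map_add, map_sub, map_smul, smul_eq_mul, XX1, XXX1, XXXX1]
      linarith
    have h2 : m (H * X1) = 2 * m (H * s1) * m (X1 * s1) := by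
      have : H * X1 = ω ^ 2 • ((f + (d * v) • 1) * X1) + (2 * m (H * s1)) • (X1 * s1) := by
        conv_lhs => rw [Hres]
        ext x; simp; ring
      rw [this]
      simp only [map_add, map_smul, smul_eq_mul, fX1]
      ring
    rw [h1, X1s] at h2
    have : m (H * s1) * r = 0 := by linarith
    exact (mul_eq_zero.1 this).resolve_right hr
  refine ⟨dX, dV, Xc, ep, X2, dX1, ?_⟩
  rw [s0] at Hres
  have e3 : ω ^ 2 • X2 = ε • H - ω ^ 2 • X := by
    have : X2 = ε • (f + (d * v) • 1) - X := by rw [e2]; abel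
    rw [this, Hres]
    ext x; simp; ring
  rw [e3, hω2, hH]
  ext x; simp; ring

end key

lemma fixpt {P F : Type*} [NormedAddCommGroup P] [NormedSpace ℝ P] [CompleteSpace P]
    [NormedAddCommGroup F] [NormedSpace ℝ F] [CompleteSpace F] (Φ : P × F → F) (q0 : P) (u0 : F)
    (hC : ContDiffAt ℝ 1 Φ (q0, u0)) (h0 : ∀ u, Φ (q0, u) = u0) :
    ∃ ψ : P → F, (∀ᶠ q in 𝓝 q0, ContinuousAt ψ q) ∧ ψ q0 = u0 ∧
      ∀ᶠ q in 𝓝 q0, Φ (q, ψ q) = ψ q := by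
  have hf : ContDiffAt ℝ 1 (fun v : P × F => v.2 - Φ v) (q0, u0) := contDiffAt_snd.sub hC
  have hid : fderiv ℝ (fun v : P × F => v.2 - Φ v) (q0, u0) ∘L .inr ℝ P F = .id ℝ F := by
    have h1 : HasFDerivAt (fun v : P × F => v.2 - Φ v)
      (fderiv ℝ (fun v : P × F => v.2 - Φ v) (q0, u0)) (q0, u0) :=
      (hf.differentiableAt (by simp)).hasFDerivAt
    have h2 : HasFDerivAt (fun u : F => (q0, u)) (.inr ℝ P F) u0 := hasFDerivAt_prodMk_right q0 u0
    have h3 := h1.comp u0 h2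
    have h4 : ((fun v : P × F => v.2 - Φ v) ∘ fun u : F => (q0, u)) = fun u => u - u0 := by
      ext u; simp [h0]
    rw [h4] at h3
    exact h3.unique ((hasFDerivAt_id u0).sub_const u0)
  have hinv : (fderiv ℝ (fun v : P × F => v.2 - Φ v) (q0, u0) ∘L .inr ℝ P F).IsInvertible := by
    rw [hid]; exact ⟨ContinuousLinearEquiv.refl ℝ F, rfl⟩
  refine ⟨hf.implicitFunction one_ne_zero hinv, ?_, hf.implicitFunction_apply_self one_ne_zero hinv, ?_⟩
  · have := hf.contDiffAt_implicitFunction one_ne_zero hinv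
    exact (this.eventually (by simp)).mono fun q hq => hq.continuousAt
  · filter_upwards [hf.eventually_apply_implicitFunction one_ne_zero hinv] with q hq
    simp only [h0, sub_self] at hq
    exact (sub_eq_zero.1 hq).symm

section maps
variable (d : ℝ) (a B C : ℝ → ℝ)

noncomputable def om (ε κ : ℝ) : ℝ := √(ε ^ 2 * κ - a ε)
noncomputable def Mf (v : ℝ) (f : E) : E := (d * v) • 1 + G f
noncomputable def Xf (ε r v : ℝ) (f : E) : E := r • c1 + ε • Mf d v f
noncomputable def X1f (ε r : ℝ) (f : E) : E := -(r • s1) + ε • G' f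
noncomputable def pN (ε r κ : ℝ) (p f : E) : E :=
  (B ε / om a ε κ) • (r • c1 + ε • G f - (d * ε) • J p)
noncomputable def vN (ε r v : ℝ) (f : E) : ℝ :=
  ((1 + a ε) * m (Xf d ε r v f * Xf d ε r v f)
    - ε * m (Xf d ε r v f * Xf d ε r v f * Xf d ε r v f)) / (1 + a ε * d)
noncomputable def fN (ε r v κ : ℝ) (p f : E) : E :=
  (om a ε κ ^ 2)⁻¹ • Pr ((ε * κ) • Xf d ε r v f + J p + (C ε * om a ε κ) • X1f ε r f
    - (1 + a ε) • (Xf d ε r v f * Xf d ε r v f)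
    + ε • (Xf d ε r v f * Xf d ε r v f * Xf d ε r v f))
noncomputable def kN (ε r v κ : ℝ) (f : E) (pn : E) (vn : ℝ) (fn : E) : ℝ :=
  r⁻¹ * (-(B ε / om a ε κ) * d * (2 * m (J pn * s1)) + (1 + a ε) * (2 * m (((2 * r) •
    (c1 * Mf d vn fn) + ε • (Mf d vn fn * Mf d vn fn)) * c1))
    - 2 * m (Xf d ε r v f * Xf d ε r v f * Xf d ε r v f * c1))

noncomputable def Phi (x : (ℝ × ℝ) × (E × ℝ × E × ℝ)) : E × ℝ × E × ℝ :=
  let ε := x.1.1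
  let r := x.1.2
  let p := x.2.1
  let v := x.2.2.1
  let f := x.2.2.2.1
  let κ := x.2.2.2.2
  let pn := pN d a B ε r κ p f
  let vn := vN d a ε r v f
  let fn := fN d a C ε r v κ pn f
  (pn, vn, fn, kN d a B ε r v κ f pn vn fn)

noncomputable def gf (N : ℝ → ℝ) (x : (ℝ × ℝ) × (E × ℝ × E × ℝ)) : ℝ :=
  let ε := x.1.1
  let r := x.1.2
  let p := x.2.1
  let f := x.2.2.2.1
  let κ := x.2.2.2.2
  r ^ 2 / 2 * (κ * C ε - N ε) + om a ε κ ^ 2 * C ε * m (G' f * G' f) - B ε * m (G f * G f)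
      + d ^ 2 * B ε * m (J p * J p)

variable {Q : Type*} [NormedAddCommGroup Q] [NormedSpace ℝ Q] {x : Q}
variable {ε r v κ vn : Q → ℝ} {p f pn fn : Q → E}

variable {d a B C}

lemma cd_Pr (hf : ContDiffAt ℝ 1 f x) : ContDiffAt ℝ 1 (fun y => Pr (f y)) x := by
  unfold Pr; fun_prop

lemma cd_om (ha : ContDiff ℝ 1 a) (hε : ContDiffAt ℝ 1 ε x) (hκ : ContDiffAt ℝ 1 κ x)
    (h0 : (ε x) ^ 2 * κ x - a (ε x) ≠ 0) : ContDiffAt ℝ 1 (fun y => om a (ε y) (κ y)) x := by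
  unfold om
  refine ContDiffAt.sqrt ?_ h0
  have : ContDiffAt ℝ 1 (fun y => a (ε y)) x := ha.contDiffAt.comp x hε
  fun_prop

lemma cd_M (hv : ContDiffAt ℝ 1 v x) (hf : ContDiffAt ℝ 1 f x) :
    ContDiffAt ℝ 1 (fun y => Mf d (v y) (f y)) x := by
  unfold Mf; fun_prop

lemma cd_X (hε : ContDiffAt ℝ 1 ε x) (hr : ContDiffAt ℝ 1 r x) (hv : ContDiffAt ℝ 1 v x)
    (hf : ContDiffAt ℝ 1 f x) :
    ContDiffAt ℝ 1 (fun y => Xf d (ε y) (r y) (v y) (f y)) x := by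
  have := cd_M (d := d) hv hf
  unfold Xf; fun_prop

lemma cd_X1 (hε : ContDiffAt ℝ 1 ε x) (hr : ContDiffAt ℝ 1 r x)
    (hf : ContDiffAt ℝ 1 f x) :
    ContDiffAt ℝ 1 (fun y => X1f (ε y) (r y) (f y)) x := by
  unfold X1f; fun_prop

lemma cd_p (ha : ContDiff ℝ 1 a) (hB : ContDiff ℝ 1 B)
    (hε : ContDiffAt ℝ 1 ε x) (hr : ContDiffAt ℝ 1 r x) (hκ : ContDiffAt ℝ 1 κ x)
    (hp : ContDiffAt ℝ 1 p x) (hf : ContDiffAt ℝ 1 f x)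
    (h0 : (ε x) ^ 2 * κ x - a (ε x) ≠ 0) (h1 : om a (ε x) (κ x) ≠ 0) :
    ContDiffAt ℝ 1 (fun y => pN d a B (ε y) (r y) (κ y) (p y) (f y)) x := by
  have := cd_om ha hε hκ h0
  have : ContDiffAt ℝ 1 (fun y => B (ε y)) x := hB.contDiffAt.comp x hε
  unfold pN; fun_prop (disch := assumption)

lemma cd_v (ha : ContDiff ℝ 1 a)
    (hε : ContDiffAt ℝ 1 ε x) (hr : ContDiffAt ℝ 1 r x) (hv : ContDiffAt ℝ 1 v x)
    (hf : ContDiffAt ℝ 1 f x) (h0 : 1 + a (ε x) * d ≠ 0) :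
    ContDiffAt ℝ 1 (fun y => vN d a (ε y) (r y) (v y) (f y)) x := by
  have : ContDiffAt ℝ 1 (fun y => a (ε y)) x := ha.contDiffAt.comp x hε
  have := cd_X (d := d) hε hr hv hf
  unfold vN; fun_prop (disch := assumption)

lemma cd_f (ha : ContDiff ℝ 1 a) (hC : ContDiff ℝ 1 C)
    (hε : ContDiffAt ℝ 1 ε x) (hr : ContDiffAt ℝ 1 r x) (hv : ContDiffAt ℝ 1 v x)
    (hκ : ContDiffAt ℝ 1 κ x)
    (hp : ContDiffAt ℝ 1 p x) (hf : ContDiffAt ℝ 1 f x)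
    (h0 : (ε x) ^ 2 * κ x - a (ε x) ≠ 0) (h1 : om a (ε x) (κ x) ≠ 0) :
    ContDiffAt ℝ 1 (fun y => fN d a C (ε y) (r y) (v y) (κ y) (p y) (f y)) x := by
  have ho := cd_om ha hε hκ h0
  have : ContDiffAt ℝ 1 (fun y => C (ε y)) x := hC.contDiffAt.comp x hε
  have : ContDiffAt ℝ 1 (fun y => a (ε y)) x := ha.contDiffAt.comp x hε
  have := cd_X (d := d) hε hr hv hf
  have := cd_X1 hε hr hf
  unfold fN
  refine ContDiffAt.smul ((ho.pow 2).inv (pow_ne_zero 2 h1)) (cd_Pr ?_)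
  fun_prop

lemma cd_k (ha : ContDiff ℝ 1 a) (hB : ContDiff ℝ 1 B)
    (hε : ContDiffAt ℝ 1 ε x) (hr : ContDiffAt ℝ 1 r x) (hv : ContDiffAt ℝ 1 v x)
    (hκ : ContDiffAt ℝ 1 κ x) (hf : ContDiffAt ℝ 1 f x)
    (hpn : ContDiffAt ℝ 1 pn x) (hvn : ContDiffAt ℝ 1 vn x) (hfn : ContDiffAt ℝ 1 fn x)
    (h0 : (ε x) ^ 2 * κ x - a (ε x) ≠ 0) (h1 : om a (ε x) (κ x) ≠ 0) (h2 : r x ≠ 0) :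
    ContDiffAt ℝ 1 (fun y => kN d a B (ε y) (r y) (v y) (κ y) (f y) (pn y) (vn y) (fn y)) x := by
  have := cd_om ha hε hκ h0
  have : ContDiffAt ℝ 1 (fun y => B (ε y)) x := hB.contDiffAt.comp x hε
  have : ContDiffAt ℝ 1 (fun y => a (ε y)) x := ha.contDiffAt.comp x hε
  have := cd_X (d := d) hε hr hv hf
  have := cd_M (d := d) hvn hfn
  unfold kN; fun_prop (disch := assumption)

lemma cd_Phi (ha : ContDiff ℝ 1 a) (hB : ContDiff ℝ 1 B) (hC : ContDiff ℝ 1 C)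
    (x : (ℝ × ℝ) × (E × ℝ × E × ℝ)) (hx : x.1.1 = 0) (h0 : a 0 < 0) (h1 : 1 + a 0 * d ≠ 0)
    (h2 : x.1.2 ≠ 0) : ContDiffAt ℝ 1 (Phi d a B C) x := by
  have h3 : (x.1.1) ^ 2 * x.2.2.2.2 - a (x.1.1) ≠ 0 := by
    rw [hx]; intro h; simp at h; linarith
  have h4 : om a x.1.1 x.2.2.2.2 ≠ 0 := by
    rw [hx, om]; apply ne_of_gt; apply Real.sqrt_pos.2; simpa using h0
  have h5 : 1 + a x.1.1 * d ≠ 0 := by rwa [hx]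
  have cε : ContDiffAt ℝ 1 (fun y : (ℝ × ℝ) × (E × ℝ × E × ℝ) => y.1.1) x := by fun_prop
  have cr : ContDiffAt ℝ 1 (fun y : (ℝ × ℝ) × (E × ℝ × E × ℝ) => y.1.2) x := by fun_prop
  have cp : ContDiffAt ℝ 1 (fun y : (ℝ × ℝ) × (E × ℝ × E × ℝ) => y.2.1) x := by fun_prop
  have cv : ContDiffAt ℝ 1 (fun y : (ℝ × ℝ) × (E × ℝ × E × ℝ) => y.2.2.1) x := by fun_prop
  have cf : ContDiffAt ℝ 1 (fun y : (ℝ × ℝ) × (E × ℝ × E × ℝ) => y.2.2.2.1) x := by fun_prop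
  have cκ : ContDiffAt ℝ 1 (fun y : (ℝ × ℝ) × (E × ℝ × E × ℝ) => y.2.2.2.2) x := by fun_prop
  have c1 := cd_p (d := d) ha hB cε cr cκ cp cf h3 h4
  have c2 := cd_v (d := d) ha cε cr cv cf h5
  have c3 := cd_f (d := d) ha hC cε cr cv cκ c1 cf h3 h4
  have c4 := cd_k (d := d) ha hB cε cr cv cκ cf c1 c2 c3 h3 h4 h2
  exact c1.prodMk (c2.prodMk (c3.prodMk c4))

lemma cont_gf {N : ℝ → ℝ} (ha : Continuous a) (hB : Continuous B) (hC : Continuous C)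
    (hN : Continuous N) : Continuous (gf d a B C N) := by
  unfold gf om; fun_prop

end maps

lemma J_c1 : J c1 = s1 := by
  refine (J_der0 m_c1).uniq s1_der ?_
  rw [J_mean, m_s1]

noncomputable def k2 : E := c1 * c1 - (1 / 2 : ℝ) • 1

lemma m_sss : m (s1 * s1 * s1) = 0 := by
  have h := (((c1_der.mul c1_der).mul c1_der)).mean
  have e : (-s1 * c1 + c1 * -s1) * c1 + c1 * c1 * -s1 = (3:ℝ) • (s1 * s1 * s1) - (3:ℝ) • s1 := by
    ext x
    simp
    linear_combination -3 * s1 x * cs_pt x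
  rw [e, map_sub, map_smul, map_smul, m_s1] at h
  simp at h
  linarith

lemma m_cccc : m (c1 * c1 * c1 * c1) = 3 / 8 := by
  have h := (((c1_der.mul c1_der).mul c1_der).mul s1_der).mean
  have e : ((-s1 * c1 + c1 * -s1) * c1 + c1 * c1 * -s1) * s1 + c1 * c1 * c1 * c1 =
      (4:ℝ) • (c1 * c1 * c1 * c1) - (3:ℝ) • (c1 * c1) := by
    ext x
    simp
    linear_combination -3 * c1 x * c1 x * cs_pt x
  rw [e, map_sub, map_smul, map_smul, m_cc] at h
  simp at h
  linarith

lemma J_ck : J (c1 * k2) = (1 / 2 : ℝ) • s1 - (1 / 3 : ℝ) • (s1 * s1 * s1) := by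
  have hd : Der ((1 / 2 : ℝ) • s1 - (1 / 3 : ℝ) • (s1 * s1 * s1)) (c1 * k2) := by
    refine ((s1_der.smul (1/2)).sub ((((s1_der.mul s1_der).mul s1_der)).smul (1/3))).congr ?_
    ext x
    simp [k2]
    linear_combination - c1 x * cs_pt x
  refine (J_der0 hd.mean).uniq hd ?_
  rw [J_mean]; simp [m_s1, m_sss]

lemma J_sk : J (s1 * k2) = (1 / 2 : ℝ) • c1 - (1 / 3 : ℝ) • (c1 * c1 * c1) := by
  have hd : Der ((1 / 2 : ℝ) • c1 - (1 / 3 : ℝ) • (c1 * c1 * c1)) (s1 * k2) := by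
    refine ((c1_der.smul (1/2)).sub ((((c1_der.mul c1_der).mul c1_der)).smul (1/3))).congr ?_
    ext x
    simp [k2]
    ring
  refine (J_der0 hd.mean).uniq hd ?_
  rw [J_mean]; simp [m_c1, m_ccc]

lemma G_k2 : G k2 = (-(1 / 3) : ℝ) • k2 := by
  rw [G_apply, J_ck, J_sk]
  ext x
  have := cs_pt x
  simp [k2]
  have e : s1 x * s1 x = 1 - c1 x * c1 x := by linarith
  linear_combination (1 / 2 - 1 / 3 * (s1 x * s1 x + (1 - c1 x * c1 x))) * e

lemma G'_k2 : G' k2 = (2 / 3 : ℝ) • (c1 * s1) := by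
  rw [G'_apply, J_ck, J_sk]
  ext x
  simp
  linear_combination (- 1 / 3 * c1 x * s1 x) * cs_pt x

lemma m_k2k2 : m (k2 * k2) = 1 / 8 := by
  have : k2 * k2 = c1 * c1 * c1 * c1 - c1 * c1 + (1 / 4 : ℝ) • 1 := by
    ext x; simp [k2]; ring
  rw [this]; simp only [map_add, map_sub, map_smul, m_cccc, m_cc, m_one]; norm_num

lemma m_cscs : m (c1 * s1 * (c1 * s1)) = 1 / 8 := by
  have : c1 * s1 * (c1 * s1) = c1 * c1 - c1 * c1 * c1 * c1 := by
    ext x; simp; linear_combination (c1 x * c1 x) * cs_pt x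
  rw [this]; simp only [map_sub, m_cccc, m_cc]; norm_num

lemma m_cck : m (c1 * c1 * k2) = 1 / 8 := by
  have : c1 * c1 * k2 = c1 * c1 * c1 * c1 - (1 / 2 : ℝ) • (c1 * c1) := by
    ext x; simp [k2]; ring
  rw [this]; simp only [map_sub, map_smul, m_cccc, m_cc]; norm_num

section base
variable {d w γ η r : ℝ} {a B C N : ℝ → ℝ}

lemma om0 (hw : 0 < w) (ha : a 0 = -w ^ 2) (κ : ℝ) : om a 0 κ = w := by
  unfold om
  rw [ha]
  simp [Real.sqrt_sq hw.le]

lemma pN0 (hw : 0 < w) (ha : a 0 = -w ^ 2) (hB : B 0 = γ * w ^ 2) (κ : ℝ) (p f : E) :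
    pN d a B 0 r κ p f = (γ * w * r) • c1 := by
  have := hw.ne'
  unfold pN
  rw [om0 hw ha, hB]
  simp [smul_smul]
  congr 1
  field_simp

lemma X0 (v : ℝ) (f : E) : Xf d 0 r v f = r • c1 := by simp [Xf]

lemma vN0 (ha : a 0 = -w ^ 2) (v : ℝ) (f : E) :
    vN d a 0 r v f = (1 - w ^ 2) * (r ^ 2 / 2) / (1 - w ^ 2 * d) := by
  unfold vN
  rw [X0, ha]
  have : (r • c1) * (r • c1) = r ^ 2 • (c1 * c1) := by ext x; simp; ring
  rw [this, map_smul, m_cc]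
  simp only [smul_eq_mul, zero_mul, sub_zero]
  congr 1 <;> ring

lemma fN0 (hw : 0 < w) (ha : a 0 = -w ^ 2) (hC : C 0 = γ) (v κ : ℝ) (f : E) :
    fN d a C 0 r v κ ((γ * w * r) • c1) f = (-((1 - w ^ 2) / w ^ 2 * r ^ 2)) • k2 := by
  have hw' := hw.ne'
  unfold fN
  rw [om0 hw ha, X0, ha, hC]
  have : (0 * κ) • r • c1 + J ((γ * w * r) • c1) + (γ * w) • X1f 0 r f
      - (1 + -w ^ 2) • (r • c1 * r • c1) + (0:ℝ) • (r • c1 * r • c1 * r • c1)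
      = (-(1 - w ^ 2) * r ^ 2) • (c1 * c1) := by
    rw [map_smul, J_c1]
    ext x; simp [X1f]; ring
  rw [this]
  have e : Pr ((-(1 - w ^ 2) * r ^ 2) • (c1 * c1)) = (-(1 - w ^ 2) * r ^ 2) • k2 := by
    unfold Pr
    have e2 : c1 * c1 * s1 = - (s1 * s1 * s1) + s1 := by
      ext x; simp; linear_combination s1 x * cs_pt x
    simp only [smul_mul_assoc, map_smul, m_cc, m_ccc, e2, map_add, map_neg, m_sss, m_s1]
    ext x; simp [k2]; ring
  rw [e, smul_smul]
  congr 1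
  field_simp

lemma g0 (hw : 0 < w) (hγ : γ ≠ 0) (hd : 1 - w ^ 2 * d ≠ 0) (hr : r ≠ 0)
    (ha : a 0 = -w ^ 2) (hB : B 0 = γ * w ^ 2) (hC : C 0 = γ) (D : ℝ)
    (hD : D = 1 - 5 * w ^ 2 + w ^ 4 + 3 * d * w ^ 2 - 3 * d * w ^ 4 + 3 * d * w ^ 6)
    (hη : η * (γ * D) = (1 - d * w ^ 2) * (w ^ 2 * γ ^ 3 * d - w ^ 4 * γ ^ 3 * d ^ 2 + N 0))
    (u : E × ℝ × E × ℝ) :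
    gf d a B C N ((0, r), Phi d a B C ((0, r), u)) =
      r ^ 2 / 2 * (γ * D / (4 * w ^ 2 * (1 - w ^ 2 * d))) * (r ^ 2 - 4 * w ^ 2 * η) := by
  have hw' := hw.ne'
  have hN : N 0 = η * (γ * D) / (1 - w ^ 2 * d) - w ^ 2 * γ ^ 3 * d + w ^ 4 * γ ^ 3 * d ^ 2 := by
    field_simp
    linear_combination -hη
  unfold gf Phi
  dsimp only
  rw [pN0 hw ha hB, vN0 ha, fN0 hw ha hC, om0 hw ha, hC, hB, hN]
  unfold kN
  rw [om0 hw ha, X0, ha, hB]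
  set v := (1 - w ^ 2) * (r ^ 2 / 2) / (1 - w ^ 2 * d) with hv
  set q := -((1 - w ^ 2) / w ^ 2 * r ^ 2) with hq
  have e1 : ((2 * r) • (c1 * Mf d v (q • k2)) + (0:ℝ) • (Mf d v (q • k2) * Mf d v (q • k2))) * c1
      = (2 * r * d * v) • (c1 * c1) + (-(2 * r * q / 3)) • (c1 * c1 * k2) := by
    unfold Mf
    rw [map_smul, G_k2]
    ext x; simp; ring
  have e2 : r • c1 * r • c1 * r • c1 * c1 = r ^ 3 • (c1 * c1 * c1 * c1) := by
    ext x; simp; ring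
  have e3 : G' (q • k2) * G' (q • k2) = (4 / 9 * q ^ 2) • (c1 * s1 * (c1 * s1)) := by
    rw [map_smul, G'_k2]; ext x; simp; ring
  have e4 : G (q • k2) * G (q • k2) = (1 / 9 * q ^ 2) • (k2 * k2) := by
    rw [map_smul, G_k2]; ext x; simp; ring
  have e5 : J ((γ * w * r) • c1) * J ((γ * w * r) • c1) = ((γ * w * r) ^ 2) • (s1 * s1) := by
    rw [map_smul, J_c1]; ext x; simp; ring
  have e6 : J ((γ * w * r) • c1) * s1 = (γ * w * r) • (s1 * s1) := by
    rw [map_smul, J_c1, smul_mul_assoc]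
  rw [e1, e2, e3, e4, e5, e6]
  simp only [map_add, map_smul, smul_eq_mul, m_cc, m_cck, m_cccc, m_cscs, m_k2k2, m_ss]
  rw [hv, hq, hD]
  field_simp
  ring

end base

lemma ode {ε r d ω a B C δ : ℝ} {p X X1 X2 V : E} (hω : 0 < ω) (hr : r ≠ 0) (hε : ε ≠ 0)
    (dX : Der X X1) (dV : Der V p) (dX1 : Der X1 X2) (Xc : m (X * c1) = r / 2)
    (ep : ω • p = B • (X - (d * ε) • V))
    (e2 : ω ^ 2 • X2 = a • X + ε • V + (ε * C * ω) • X1 - (ε * (1 + a)) • (X * X)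
      + ε ^ 2 • (X * X * X))
    (b1 : |ε| * ‖X‖ < δ) (b2 : ε ^ 2 * ‖V‖ < δ) (b3 : |ε| * ω * ‖X1‖ < δ) :
    ∃ (φ : ℝ → ℝ × ℝ × ℝ) (T : ℝ), 0 < T ∧
        (∀ t, HasDerivAt φ
          ((φ t).2.2,
           (ε * B) * ((φ t).1 - d * (φ t).2.1),
           ((φ t).1 - a) * ((φ t).1 - 1) * (φ t).1 + (φ t).2.1 + (ε * C) * (φ t).2.2) t) ∧
        (∀ t, φ (t + T) = φ t) ∧
        (∃ t s, φ t ≠ φ s) ∧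
        (∀ t, ‖φ t‖ < δ) := by
  refine ⟨fun t => (ε * X ((ω * t : ℝ) : Cir), ε ^ 2 * V ((ω * t : ℝ) : Cir),
    ε * ω * X1 ((ω * t : ℝ) : Cir)), 2 * Real.pi / ω, div_pos Real.two_pi_pos hω, ?_, ?_, ?_, ?_⟩
  · intro t
    have hl : HasDerivAt (fun t : ℝ => ω * t) ω t := by
      simpa using (hasDerivAt_id t).const_mul ω
    have h1 := ((dX (ω * t)).comp t hl).const_mul ε
    have h2 := ((dV (ω * t)).comp t hl).const_mul (ε ^ 2)
    have h3 := ((dX1 (ω * t)).comp t hl).const_mul (ε * ω)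
    have ep' := congrArg (fun f : E => f ((ω * t : ℝ) : Cir)) ep
    have e2' := congrArg (fun f : E => f ((ω * t : ℝ) : Cir)) e2
    simp only [ContinuousMap.smul_apply, ContinuousMap.sub_apply, ContinuousMap.add_apply,
      ContinuousMap.mul_apply, smul_eq_mul] at ep' e2'
    refine (h1.prodMk (h2.prodMk h3)).congr_deriv ?_
    refine Prod.ext ?_ (Prod.ext ?_ ?_)
    · dsimp only; ring
    · dsimp only; linear_combination ε ^ 2 * ep'
    · dsimp only; linear_combination ε * e2'
  · intro t
    have : (((ω * (t + 2 * Real.pi / ω) : ℝ)) : Cir) = ((ω * t : ℝ) : Cir) := by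
      rw [mul_add, mul_div_cancel₀ _ hω.ne', AddCircle.coe_add, AddCircle.coe_period, add_zero]
    simp only [this]
  · by_contra! hcon
    have hX : X = (X ((0 : ℝ) : Cir)) • (1 : E) := by
      apply coe_ext; intro t
      have := congrArg Prod.fst (hcon (t / ω) 0)
      simp only [mul_div_cancel₀ _ hω.ne', mul_zero] at this
      simpa using mul_left_cancel₀ hε this
    rw [hX, smul_mul_assoc, one_mul, map_smul, m_c1, smul_zero] at Xc
    apply hr; linarith
  · intro t
    rw [Prod.norm_def, Prod.norm_def]
    refine max_lt ?_ (max_lt ?_ ?_)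
    · dsimp only; rw [norm_mul, Real.norm_eq_abs ε]
      exact (mul_le_mul_of_nonneg_left (X.norm_coe_le_norm _) (abs_nonneg _)).trans_lt b1
    · dsimp only; rw [norm_mul, Real.norm_of_nonneg (sq_nonneg ε)]
      exact (mul_le_mul_of_nonneg_left (V.norm_coe_le_norm _) (sq_nonneg _)).trans_lt b2
    · dsimp only; rw [norm_mul, norm_mul, Real.norm_eq_abs ε, Real.norm_of_nonneg hω.le]
      exact (mul_le_mul_of_nonneg_left (X1.norm_coe_le_norm _) (by positivity)).trans_lt b3

noncomputable def Nb (d : ℝ) (a : ℝ → ℝ) (x : (ℝ × ℝ) × (E × ℝ × E × ℝ)) : ℝ :=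
  |x.1.1| * ‖Xf d x.1.1 x.1.2 x.2.2.1 x.2.2.2.1‖ + x.1.1 ^ 2 * ‖x.2.2.1 • (1:E) + J x.2.1‖
    + |x.1.1| * om a x.1.1 x.2.2.2.2 * ‖X1f x.1.1 x.1.2 x.2.2.2.1‖

lemma cont_Nb {d : ℝ} {a : ℝ → ℝ} (ha : Continuous a) : Continuous (Nb d a) := by
  unfold Nb om Xf X1f Mf; fun_prop

lemma core {w d γ η : ℝ} {a B C N : ℝ → ℝ} (hw : 0 < w) (hγ : γ ≠ 0) (hd : 1 - w ^ 2 * d ≠ 0)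
    (ha : a 0 = -w ^ 2) (hB : B 0 = γ * w ^ 2) (hC : C 0 = γ) (D : ℝ)
    (hD : D = 1 - 5 * w ^ 2 + w ^ 4 + 3 * d * w ^ 2 - 3 * d * w ^ 4 + 3 * d * w ^ 6)
    (hD0 : D ≠ 0) (hη0 : 0 < η)
    (hη : η * (γ * D) = (1 - d * w ^ 2) * (w ^ 2 * γ ^ 3 * d - w ^ 4 * γ ^ 3 * d ^ 2 + N 0))
    (sa : ContDiff ℝ 1 a) (sB : ContDiff ℝ 1 B) (sC : ContDiff ℝ 1 C) (sN : Continuous N)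
    (hN : ∀ ε, a ε * C ε + B ε = ε ^ 2 * N ε) :
    ∀ δ > 0, ∃ ε₀ > 0, ∀ ε : ℝ, 0 < |ε| → |ε| < ε₀ →
      ∃ (φ : ℝ → ℝ × ℝ × ℝ) (T : ℝ), 0 < T ∧
        (∀ t, HasDerivAt φ
          ((φ t).2.2,
           (ε * B ε) * ((φ t).1 - d * (φ t).2.1),
           ((φ t).1 - a ε) * ((φ t).1 - 1) * (φ t).1 + (φ t).2.1 + (ε * C ε) * (φ t).2.2) t) ∧
        (∀ t, φ (t + T) = φ t) ∧
        (∃ t s, φ t ≠ φ s) ∧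
        (∀ t, ‖φ t‖ < δ) := by
  intro δ hδ
  set r0 : ℝ := 2 * w * √η with hr0
  have hr0p : 0 < r0 := by positivity
  have hr0s : r0 ^ 2 = 4 * w ^ 2 * η := by
    rw [hr0, mul_pow, Real.sq_sqrt hη0.le]; ring
  have hw2 : 0 < w ^ 2 := by positivity
  have hconst : ∀ u, Phi d a B C ((0, r0), u) = Phi d a B C ((0, r0), 0) := by
    intro u
    unfold Phi
    dsimp only
    unfold kN
    simp only [pN0 hw ha hB, vN0 ha, fN0 hw ha hC, om0 hw ha, X0]
  obtain ⟨ψ, hψc, hψ0, hψ⟩ := fixpt (Phi d a B C) (0, r0) (Phi d a B C ((0, r0), 0))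
    (cd_Phi sa sB sC _ rfl (by rw [ha]; linarith)
      (by rw [ha]; intro h; apply hd; linarith) hr0p.ne') hconst
  have hψat : ContinuousAt (fun q : ℝ × ℝ => (q, ψ q)) (0, r0) :=
    continuousAt_id.prodMk hψc.self_of_nhds
  have e3 : ∀ᶠ q in 𝓝 ((0, r0) : ℝ × ℝ), Nb d a (q, ψ q) < δ := by
    have hc : ContinuousAt (fun q : ℝ × ℝ => Nb d a (q, ψ q)) (0, r0) :=
      ContinuousAt.comp (f := fun q : ℝ × ℝ => (q, ψ q)) (cont_Nb sa.continuous).continuousAt hψat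
    refine hc.eventually_lt continuousAt_const ?_
    simpa [Nb] using hδ
  have e4 : ∀ᶠ q in 𝓝 ((0, r0) : ℝ × ℝ), 0 < q.1 ^ 2 * (ψ q).2.2.2 - a q.1 := by
    have hc : ContinuousAt (fun q : ℝ × ℝ => q.1 ^ 2 * (ψ q).2.2.2 - a q.1) (0, r0) := by
      have h1 : Continuous (fun x : (ℝ × ℝ) × (E × ℝ × E × ℝ) =>
        x.1.1 ^ 2 * x.2.2.2.2 - a x.1.1) := by
        have := sa.continuous
        fun_prop
      exact ContinuousAt.comp (f := fun q : ℝ × ℝ => (q, ψ q)) h1.continuousAt hψat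
    refine continuousAt_const.eventually_lt hc ?_
    simp [ha, hw]
  have e5 : ∀ᶠ q in 𝓝 ((0, r0) : ℝ × ℝ), 1 + a q.1 * d ≠ 0 := by
    have hc : Continuous (fun q : ℝ × ℝ => 1 + a q.1 * d) := by
      have := sa.continuous
      fun_prop
    refine hc.continuousAt.eventually_ne ?_
    rw [ha]; intro h; apply hd; linarith
  have e6 : ∀ᶠ q in 𝓝 ((0, r0) : ℝ × ℝ), 0 < q.2 :=
    continuousAt_const.eventually_lt continuous_snd.continuousAt hr0p
  obtain ⟨ρ, hρ, hall⟩ := Metric.eventually_nhds_iff_ball.1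
    (hψc.and (hψ.and (e3.and (e4.and (e5.and e6)))))
  have hball : ∀ ε r : ℝ, |ε| < ρ → |r - r0| < ρ → ((ε, r) : ℝ × ℝ) ∈ Metric.ball (0, r0) ρ := by
    intro ε r h1 h2
    rw [Metric.mem_ball, Prod.dist_eq, Real.dist_eq, Real.dist_eq]
    exact max_lt (by simpa using h1) h2
  set K := γ * D / (4 * w ^ 2 * (1 - w ^ 2 * d)) with hK
  have hK0 : K ≠ 0 := by
    rw [hK]
    exact div_ne_zero (mul_ne_zero hγ hD0) (mul_ne_zero (by positivity) hd)
  set h : ℝ × ℝ → ℝ := fun q => K * gf d a B C N (q, ψ q) with hh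
  have hcont : ∀ q ∈ Metric.ball ((0, r0) : ℝ × ℝ) ρ, ContinuousAt h q := by
    intro q hq
    have h1 : ContinuousAt (fun q : ℝ × ℝ => (q, ψ q)) q := continuousAt_id.prodMk (hall q hq).1
    have h2 : ContinuousAt (fun q : ℝ × ℝ => gf d a B C N (q, ψ q)) q :=
      ContinuousAt.comp (f := fun q : ℝ × ℝ => (q, ψ q))
      (cont_gf (d := d) sa.continuous sB.continuous sC.continuous sN).continuousAt h1
    exact h2.const_mul K
  have hval : ∀ r, |r - r0| < ρ → h (0, r) = r ^ 2 / 2 * K ^ 2 * (r ^ 2 - r0 ^ 2) := by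
    intro r hr
    have hq := hall _ (hball 0 r (by simpa using hρ) hr)
    rw [hh]
    dsimp only
    rw [← hq.2.1, g0 hw hγ hd hq.2.2.2.2.2.ne' ha hB hC D hD hη, ← hK, hr0s]
    ring
  have hr1 : |(r0 - ρ / 2) - r0| < ρ := by
    rw [abs_lt]; constructor <;> linarith
  have hr2 : |(r0 + ρ / 2) - r0| < ρ := by
    rw [abs_lt]; constructor <;> linarith
  have hr1p : 0 < r0 - ρ / 2 := (hall _ (hball 0 _ (by simpa using hρ) hr1)).2.2.2.2.2
  have hK2 : 0 < K ^ 2 := by positivity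
  have n1 : h (0, r0 - ρ / 2) < 0 := by
    rw [hval _ hr1]
    have : (r0 - ρ / 2) ^ 2 - r0 ^ 2 < 0 := by nlinarith
    exact mul_neg_of_pos_of_neg (by positivity) this
  have n2 : 0 < h (0, r0 + ρ / 2) := by
    rw [hval _ hr2]
    have : 0 < (r0 + ρ / 2) ^ 2 - r0 ^ 2 := by nlinarith
    exact mul_pos (by positivity) this
  have c1' : ContinuousAt (fun ε : ℝ => h (ε, r0 - ρ / 2)) 0 :=
    ContinuousAt.comp (f := fun ε : ℝ => (ε, r0 - ρ / 2))
      (hcont _ (hball 0 _ (by simpa using hρ) hr1)) (by fun_prop)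
  have c2' : ContinuousAt (fun ε : ℝ => h (ε, r0 + ρ / 2)) 0 :=
    ContinuousAt.comp (f := fun ε : ℝ => (ε, r0 + ρ / 2))
      (hcont _ (hball 0 _ (by simpa using hρ) hr2)) (by fun_prop)
  obtain ⟨ε₁, hε₁, hs⟩ := Metric.eventually_nhds_iff_ball.1
    ((c1'.eventually_lt continuousAt_const n1).and (continuousAt_const.eventually_lt c2' n2))
  refine ⟨min ε₁ ρ, lt_min hε₁ hρ, ?_⟩
  intro ε hε hεlt
  have hεne : ε ≠ 0 := abs_pos.1 hε
  have hερ : |ε| < ρ := hεlt.trans_le (min_le_right _ _)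
  obtain ⟨s1', s2'⟩ := hs ε (by simpa using hεlt.trans_le (min_le_left _ _))
  have hin : ∀ r ∈ Icc (r0 - ρ / 2) (r0 + ρ / 2), |r - r0| < ρ := by
    intro r hr
    rw [abs_lt]; constructor <;> linarith [hr.1, hr.2]
  have hco : ContinuousOn (fun r : ℝ => h (ε, r)) (Icc (r0 - ρ / 2) (r0 + ρ / 2)) := by
    intro r hr
    refine ContinuousAt.continuousWithinAt ?_
    exact ContinuousAt.comp (f := fun r : ℝ => (ε, r)) (hcont _ (hball ε r hερ (hin r hr)))
      (by fun_prop)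
  obtain ⟨r, hrI, hr⟩ := intermediate_value_Icc (by linarith) hco ⟨s1'.le, s2'.le⟩
  obtain ⟨-, hfix, hNb, hpos, had, hrp⟩ := hall _ (hball ε r hερ (hin r hrI))
  have hg : gf d a B C N ((ε, r), ψ (ε, r)) = 0 := (mul_eq_zero.1 hr).resolve_left hK0
  generalize ψ (ε, r) = u at hfix hNb hpos hg
  obtain ⟨p, v, f, κ⟩ := u
  dsimp only at hpos had hrp
  unfold Phi at hfix
  dsimp only at hfix
  simp only [Prod.mk.injEq] at hfix
  obtain ⟨hp, hv, hf, hκ⟩ := hfix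
  rw [hp] at hf hκ
  rw [hv, hf] at hκ
  have hωp : 0 < om a ε κ := Real.sqrt_pos.2 hpos
  have hω2 : om a ε κ ^ 2 = ε ^ 2 * κ - a ε := Real.sq_sqrt hpos.le
  obtain ⟨dX, dV, Xc, ep, X2, dX1, e2⟩ := key (C := C ε) (B := B ε) (N := N ε) (a := a ε)
    (ω := om a ε κ) (d := d) (p := p) (f := f) (v := v) (κ := κ)
    hεne hrp.ne' hωp.ne' hω2 (M := Mf d v f) rfl (X := Xf d ε r v f) rfl
    (X1 := X1f ε r f) rfl (V := v • (1:E) + J p) rfl hp.symm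
    (by
      rw [vN, div_eq_iff had] at hv
      linarith) hf.symm
    (by
      rw [kN, inv_mul_eq_iff_eq_mul₀ hrp.ne'] at hκ
      linarith) (hN ε) hg
  unfold Nb at hNb
  dsimp only at hNb
  have q1 : 0 ≤ |ε| * ‖Xf d ε r v f‖ := by positivity
  have q2 : 0 ≤ ε ^ 2 * ‖v • (1:E) + J p‖ := by positivity
  have q3 : 0 ≤ |ε| * om a ε κ * ‖X1f ε r f‖ := by positivity
  exact ode hωp hrp.ne' hεne dX dV dX1 Xc ep e2 (by linarith) (by linarith) (by linarith)

end FHN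

/-- **Theorem B, Class B2 (Q1).** For Family B parameters with `d ≠ 1/w²`,
`β₁ = γ₁w²`, `β₂ = w²γ₂ - α₁γ₁`, `γ₁ ≠ 0` and `η > 0`, for every `δ > 0` and
all sufficiently small `ε ≠ 0` the FitzHugh–Nagumo system has a nonconstant
periodic solution contained in the ball of radius `δ` about the origin. -/
theorem fhn_classB2_periodic_solution
    (w d α₁ α₂ α₃ α₄ α₅ β₁ β₂ β₃ β₄ β₅ γ₁ γ₂ γ₃ γ₄ γ₅ : ℝ) (hw : 0 < w)
    (hd : d ≠ 1 / w ^ 2) (hβ₁ : β₁ = γ₁ * w ^ 2)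
    (hβ₂ : β₂ = w ^ 2 * γ₂ - α₁ * γ₁) (hγ₁ : γ₁ ≠ 0)
    (hden : 1 - 5 * w ^ 2 + w ^ 4 + 3 * d * w ^ 2 - 3 * d * w ^ 4 + 3 * d * w ^ 6 ≠ 0)
    (η : ℝ)
    (hη : η = (1 - d * w ^ 2)
        * (w ^ 2 * γ₁ ^ 3 * d - w ^ 4 * γ₁ ^ 3 * d ^ 2 - w ^ 2 * γ₃ + α₁ * γ₂ + α₂ * γ₁ + β₃)
        / (γ₁ * (1 - 5 * w ^ 2 + w ^ 4 + 3 * d * w ^ 2 - 3 * d * w ^ 4 + 3 * d * w ^ 6)))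
    (hηpos : 0 < η)
    (a b c : ℝ → ℝ)
    (ha : ∀ ε, a ε = -w ^ 2 + ε * α₁ + ε ^ 2 * α₂ + ε ^ 3 * α₃ + ε ^ 4 * α₄ + ε ^ 5 * α₅)
    (hb : ∀ ε, b ε = ε * β₁ + ε ^ 2 * β₂ + ε ^ 3 * β₃ + ε ^ 4 * β₄ + ε ^ 5 * β₅)
    (hc : ∀ ε, c ε = ε * γ₁ + ε ^ 2 * γ₂ + ε ^ 3 * γ₃ + ε ^ 4 * γ₄ + ε ^ 5 * γ₅) :
    ∀ δ > 0, ∃ ε₀ > 0, ∀ ε : ℝ, 0 < |ε| → |ε| < ε₀ →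
      ∃ (φ : ℝ → ℝ × ℝ × ℝ) (T : ℝ), 0 < T ∧
        (∀ t, HasDerivAt φ
          ((φ t).2.2,
           b ε * ((φ t).1 - d * (φ t).2.1),
           ((φ t).1 - a ε) * ((φ t).1 - 1) * (φ t).1 + (φ t).2.1 + c ε * (φ t).2.2) t) ∧
        (∀ t, φ (t + T) = φ t) ∧
        (∃ t s, φ t ≠ φ s) ∧
        (∀ t, ‖φ t‖ < δ) := by
  have hw0 : w ≠ 0 := hw.ne'
  have hd' : 1 - w ^ 2 * d ≠ 0 := by
    intro h
    apply hd
    rw [eq_div_iff (pow_ne_zero 2 hw0)]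
    linarith
  have hη' : η * (γ₁ * (1 - 5 * w ^ 2 + w ^ 4 + 3 * d * w ^ 2 - 3 * d * w ^ 4 + 3 * d * w ^ 6))
      = (1 - d * w ^ 2) * (w ^ 2 * γ₁ ^ 3 * d - w ^ 4 * γ₁ ^ 3 * d ^ 2
        + (-w ^ 2 * γ₃ + β₃ + α₁ * γ₂ + α₂ * γ₁)) := by
    rw [hη, div_mul_cancel₀ _ (mul_ne_zero hγ₁ hden)]
    ring
  have haf : a = fun ε => -w ^ 2 + ε * α₁ + ε ^ 2 * α₂ + ε ^ 3 * α₃ + ε ^ 4 * α₄ + ε ^ 5 * α₅ :=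
    funext ha
  have hcore := FHN.core (w := w) (d := d) (γ := γ₁) (η := η) (a := a)
    (B := fun ε => β₁ + ε * β₂ + ε ^ 2 * β₃ + ε ^ 3 * β₄ + ε ^ 4 * β₅)
    (C := fun ε => γ₁ + ε * γ₂ + ε ^ 2 * γ₃ + ε ^ 3 * γ₄ + ε ^ 4 * γ₅)
    (N := fun ε => (-w ^ 2 * γ₃ + β₃ + α₁ * γ₂ + α₂ * γ₁)
      + ε * (-w ^ 2 * γ₄ + β₄ + α₁ * γ₃ + α₂ * γ₂ + α₃ * γ₁)
      + ε ^ 2 * (-w ^ 2 * γ₅ + β₅ + α₁ * γ₄ + α₂ * γ₃ + α₃ * γ₂ + α₄ * γ₁)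
      + ε ^ 3 * (α₁ * γ₅ + α₂ * γ₄ + α₃ * γ₃ + α₄ * γ₂ + α₅ * γ₁)
      + ε ^ 4 * (α₂ * γ₅ + α₃ * γ₄ + α₄ * γ₃ + α₅ * γ₂)
      + ε ^ 5 * (α₃ * γ₅ + α₄ * γ₄ + α₅ * γ₃)
      + ε ^ 6 * (α₄ * γ₅ + α₅ * γ₄) + ε ^ 7 * (α₅ * γ₅))
    hw hγ₁ hd' (by rw [ha]; ring) (by simp [hβ₁]) (by simp) _ rfl hden hηpos
    (by rw [hη']; simp) (by rw [haf]; fun_prop) (by fun_prop) (by fun_prop) (by fun_prop)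
    (by intro ε; rw [ha, hβ₁, hβ₂]; ring)
  intro δ hδ
  obtain ⟨ε₀, h0, hmain⟩ := hcore δ hδ
  refine ⟨ε₀, h0, fun ε h1 h2 => ?_⟩
  have eb : b ε = ε * (β₁ + ε * β₂ + ε ^ 2 * β₃ + ε ^ 3 * β₄ + ε ^ 4 * β₅) := by rw [hb]; ring
  have ec : c ε = ε * (γ₁ + ε * γ₂ + ε ^ 2 * γ₃ + ε ^ 3 * γ₄ + ε ^ 4 * γ₅) := by rw [hc]; ring
  rw [eb, ec]
  exact hmain ε h1 h2
end

section
/- Let a⁰₂₂ be a nonzero real number and let A₁ = ![![a¹₁₁, a¹₁₂], ![a¹₂₁, a¹₂₂]], A₂ = ![![a²₁₁, a²₁₂], ![a²₂₁, a²₂₂]] be 2×2 real matrices, and set A₀ = ![![0,0],![0,a⁰₂₂]]. For ε ∈ ℝ define A(ε) = A₀ + ε·A₁ + ε²·A₂ and T(ε) = 1 + ε·![![0, a¹₁₂/a⁰₂₂], ![−a¹₂₁/a⁰₂₂, 0]] + ε²·![![0, (a²₁₂·a⁰₂₂ + a¹₁₂(a¹₁₁ − a¹₂₂))/(a⁰₂₂)²],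 ![−(a²₂₁·a⁰₂₂ + a¹₂₁(a¹₁₁ − a¹₂₂))/(a⁰₂₂)², 0]]. Then there exists ε₁ > 0 such that T(ε) is invertible for all |ε| < ε₁, and the function ε ↦ T(ε)⁻¹·A(ε)·T(ε) − (D₀ + ε·D₁ + ε²·D₂) is O(ε³) as ε → 0, where D₀ = diag(0, a⁰₂₂), D₁ = diag(a¹₁₁, a¹₂₂), and D₂ = diag((a⁰₂₂·a²₁₁ − a¹₁₂·a¹₂₁)/a⁰₂₂, (a⁰₂₂·a²₂₂ + a¹₁₂·a¹₂₁)/a⁰₂₂). -/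
open Asymptotics Filter

/-- **Lemma 4.2.** Block-diagonalization of the two-parameter matrix family
`A(ε) = A₀ + εA₁ + ε²A₂` with `A₀ = diag(0, a⁰₂₂)`, `a⁰₂₂ ≠ 0`: the explicit
transformation `T(ε)` is invertible for small `ε` and conjugates `A(ε)` to
`D₀ + εD₁ + ε²D₂` up to an `O(ε³)` error. -/
theorem matrix_block_diagonalization
    (a022 a111 a112 a121 a122 a211 a212 a221 a222 : ℝ) (h : a022 ≠ 0)
    (A₀ A₁ A₂ : Matrix (Fin 2) (Fin 2) ℝ)
    (hA₀ : A₀ = !![0, 0; 0, a022])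
    (hA₁ : A₁ = !![a111, a112; a121, a122])
    (hA₂ : A₂ = !![a211, a212; a221, a222])
    (A T : ℝ → Matrix (Fin 2) (Fin 2) ℝ)
    (hA : ∀ ε, A ε = A₀ + ε • A₁ + ε ^ 2 • A₂)
    (hT : ∀ ε, T ε = 1 + ε • !![0, a112 / a022; -(a121 / a022), 0]
        + ε ^ 2 • !![0, (a212 * a022 + a112 * (a111 - a122)) / a022 ^ 2;
            -((a221 * a022 + a121 * (a111 - a122)) / a022 ^ 2), 0])
    (D₀ D₁ D₂ : Matrix (Fin 2) (Fin 2) ℝ)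
    (hD₀ : D₀ = !![0, 0; 0, a022])
    (hD₁ : D₁ = !![a111, 0; 0, a122])
    (hD₂ : D₂ = !![(a022 * a211 - a112 * a121) / a022, 0;
                   0, (a022 * a222 + a112 * a121) / a022]) :
    ∃ ε₁ > 0, (∀ ε : ℝ, |ε| < ε₁ → IsUnit (T ε)) ∧
      ∀ i j : Fin 2,
        (fun ε : ℝ => ((T ε)⁻¹ * A ε * T ε - (D₀ + ε • D₁ + ε ^ 2 • D₂)) i j)
          =O[nhds (0 : ℝ)] fun ε : ℝ => ε ^ 3 := by
  -- the proof multiplies by T and reads off the polynomial remainder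
  have hTc : Continuous T := by
    rw [show T = _ from funext hT]
    fun_prop
  have hT0 : T 0 = 1 := by rw [hT]; simp
  have hdc : Continuous (fun ε => (T ε).det) := hTc.matrix_det
  have hd0 : (T 0).det ≠ 0 := by rw [hT0]; simp
  have hev : ∀ᶠ ε in nhds (0 : ℝ), (T ε).det ≠ 0 := hdc.continuousAt.eventually_ne hd0
  obtain ⟨ε₁, hε₁, hball⟩ := Metric.eventually_nhds_iff.1 hev
  refine ⟨ε₁, hε₁, fun ε hε => ?_, fun i j => ?_⟩
  · rw [Matrix.isUnit_iff_isUnit_det]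
    exact isUnit_iff_ne_zero.2 (hball (by simpa [Real.dist_eq] using hε))
  set S₁ : Matrix (Fin 2) (Fin 2) ℝ := !![0, a112 / a022; -(a121 / a022), 0] with hS₁
  set S₂ : Matrix (Fin 2) (Fin 2) ℝ :=
    !![0, (a212 * a022 + a112 * (a111 - a122)) / a022 ^ 2;
            -((a221 * a022 + a121 * (a111 - a122)) / a022 ^ 2), 0] with hS₂
  set R : ℝ → Matrix (Fin 2) (Fin 2) ℝ := fun ε =>
    (A₂ * S₁ + A₁ * S₂ - S₁ * D₂ - S₂ * D₁) + ε • (A₂ * S₂ - S₂ * D₂) with hR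
  have hRc : Continuous R := by rw [hR]; fun_prop
  have key : ∀ ε, A ε * T ε - T ε * (D₀ + ε • D₁ + ε ^ 2 • D₂) = ε ^ 3 • R ε := by
    intro ε
    have e0 : A₀ = D₀ := by rw [hA₀, hD₀]
    have e1 : A₁ + A₀ * S₁ - S₁ * D₀ - D₁ = 0 := by
      rw [hA₀, hA₁, hD₀, hD₁, hS₁]
      ext i j
      fin_cases i <;> fin_cases j <;> simp [Matrix.mul_apply, Fin.sum_univ_two] <;> field_simp <;> ring
    have e2 : A₂ + A₁ * S₁ + A₀ * S₂ - S₂ * D₀ - S₁ * D₁ - D₂ = 0 := by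
      rw [hA₀, hA₁, hA₂, hD₀, hD₁, hD₂, hS₁, hS₂]
      ext i j
      fin_cases i <;> fin_cases j <;> simp [Matrix.mul_apply, Fin.sum_univ_two] <;> field_simp <;> ring
    have : A ε * T ε - T ε * (D₀ + ε • D₁ + ε ^ 2 • D₂) = (A₀ - D₀)
        + ε • (A₁ + A₀ * S₁ - S₁ * D₀ - D₁)
        + ε ^ 2 • (A₂ + A₁ * S₁ + A₀ * S₂ - S₂ * D₀ - S₁ * D₁ - D₂) + ε ^ 3 • R ε := by
      rw [hA, hT, hR]
      simp only [add_mul, mul_add, smul_mul_assoc, mul_smul_comm, one_mul, mul_one]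
      module
    rw [this, e1, e2, e0]
    simp
  have hcont : ContinuousAt (fun ε => ((T ε).det)⁻¹ * ((T ε).adjugate * R ε) i j) 0 := by
    refine (hdc.continuousAt.inv₀ hd0).mul ?_
    exact ((hTc.matrix_adjugate.mul hRc).matrix_elem i j).continuousAt
  have hO := (hcont.isBigO_one ℝ).mul (isBigO_refl (fun ε : ℝ => ε ^ 3) (nhds 0))
  simp only [one_mul] at hO
  refine hO.congr' ?_ EventuallyEq.rfl
  filter_upwards [hev] with ε hε
  have hu : IsUnit (T ε).det := isUnit_iff_ne_zero.2 hε
  have : (T ε)⁻¹ * A ε * T ε - (D₀ + ε • D₁ + ε ^ 2 • D₂) = ε ^ 3 • ((T ε)⁻¹ * R ε) := by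
    rw [← mul_smul_comm, ← key, mul_sub, ← mul_assoc, ← mul_assoc, Matrix.nonsing_inv_mul _ hu,
      one_mul]
  rw [this, Matrix.inv_def, Ring.inverse_eq_inv', smul_mul_assoc]
  simp only [Matrix.smul_apply, smul_eq_mul]
  ring
end

section
/- Let w, α₁, β₂, γ₁, γ₂ be real numbers with w > 0, γ₁(w² − 1) > 0, α₁·γ₁ ≠ 0, and set k₀ = (γ₁α₁ − w²γ₂ + β₂)(γ₁α₁ + w²γ₂ − β₂). Define g₂ : ℝ² → ℝ² by g₂¹(r,z) = rπ(2γ₁z − w²γ₁α₁ − 2w²γ₁z − w²β₂ + w⁴γ₂)/w⁵ and g₂²(r,z) = γ₁π((w² − 1)(r²w⁴ + 8z²) + 8w²α₁z)/(4w⁵), and let r⋆ = √2·√k₀/|(w² − 1)γ₁| and z⋆ = w²(w²γ₂ − γ₁α₁ − β₂)/(2γ₁(w² − 1)), regarded as functions of the parameter β₂. If (β₂ − γ₂w²)² < 2k₀, then the 2×2 Jacobian matrix Dg₂ evaluated at (r⋆, z⋆), viewed over ℂ, has a pair of non-real complex conjugate eigenvalues whose common real part equals −π(β₂ − γ₂w²)/w³.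 In particular, when β₂ = γ₂·w² these eigenvalues are purely imaginary and equal ±i·w₀ with w₀ = √2·π·|α₁·γ₁|/w³, and the real part, as a function of β₂, vanishes at β₂ = γ₂w² with strictly negative derivative −π/w³. -/
open Real

theorem fhn_spec (M : Matrix (Fin 2) (Fin 2) ℝ) (t q : ℝ) (h00 : M 0 0 = 0)
    (h11 : M 1 1 = t) (hq : M 0 1 * M 1 0 = -q) (μ : ℂ) (h : μ ^ 2 - t * μ + q = 0) :
    μ ∈ spectrum ℂ (M.map Complex.ofReal) := by
  rw [spectrum.mem_iff, Matrix.isUnit_iff_isUnit_det, isUnit_iff_ne_zero, not_not,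
    Matrix.det_fin_two]
  have hq' : (M 0 1 : ℂ) * (M 1 0 : ℂ) = -q := by exact_mod_cast hq
  simp [Matrix.algebraMap_matrix_apply, h00, h11]
  linear_combination h - hq'

/-- Hopf (Neimark–Sacker) non-degeneracy and transversality conditions for the
torus bifurcation in Class B1: if `(β₂ - γ₂w²)² < 2k₀` then `Dg₂(r⋆, z⋆)` has
a pair of non-real complex conjugate eigenvalues with common real part
`-π(β₂ - γ₂w²)/w³`; at `β₂ = γ₂w²` these are `±i·w₀` with
`w₀ = √2·π·|α₁γ₁|/w³`, and the real part vanishes at `β₂ = γ₂w²` with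
derivative `-π/w³ < 0`. -/
theorem fhn_classB1_torus_eigenvalue_conditions
    (w α₁ β₂ γ₁ γ₂ : ℝ) (hw : 0 < w) (hγ : γ₁ * (w ^ 2 - 1) > 0)
    (hαγ : α₁ * γ₁ ≠ 0)
    (k₀ : ℝ) (hk₀ : k₀ = (γ₁ * α₁ - w ^ 2 * γ₂ + β₂) * (γ₁ * α₁ + w ^ 2 * γ₂ - β₂))
    (hdisc : (β₂ - γ₂ * w ^ 2) ^ 2 < 2 * k₀)
    (g₂ : ℝ → ℝ → ℝ × ℝ)
    (hg₂ : ∀ r z, g₂ r z =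
      (r * π * (2 * γ₁ * z - w ^ 2 * γ₁ * α₁ - 2 * w ^ 2 * γ₁ * z - w ^ 2 * β₂
          + w ^ 4 * γ₂) / w ^ 5,
       γ₁ * π * ((w ^ 2 - 1) * (r ^ 2 * w ^ 4 + 8 * z ^ 2) + 8 * w ^ 2 * α₁ * z)
          / (4 * w ^ 5)))
    (rs zs : ℝ)
    (hrs : rs = Real.sqrt 2 * Real.sqrt k₀ / |(w ^ 2 - 1) * γ₁|)
    (hzs : zs = w ^ 2 * (w ^ 2 * γ₂ - γ₁ * α₁ - β₂) / (2 * γ₁ * (w ^ 2 - 1)))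
    (Dg₂ : ℝ → ℝ → Matrix (Fin 2) (Fin 2) ℝ)
    (hDg₂ : ∀ r z, Dg₂ r z =
      ![![deriv (fun r' => (g₂ r' z).1) r, deriv (fun z' => (g₂ r z').1) z],
        ![deriv (fun r' => (g₂ r' z).2) r, deriv (fun z' => (g₂ r z').2) z]])
    (w₀ : ℝ) (hw₀ : w₀ = Real.sqrt 2 * π * |α₁ * γ₁| / w ^ 3) :
    (∃ μ : ℂ, μ.im ≠ 0 ∧
        μ ∈ spectrum ℂ (((Dg₂ rs zs).map Complex.ofReal)) ∧
        (starRingEnd ℂ) μ ∈ spectrum ℂ (((Dg₂ rs zs).map Complex.ofReal)) ∧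
        μ.re = -(π * (β₂ - γ₂ * w ^ 2)) / w ^ 3) ∧
    (β₂ = γ₂ * w ^ 2 →
        (Complex.I * w₀ ∈ spectrum ℂ (((Dg₂ rs zs).map Complex.ofReal)) ∧
         -(Complex.I * w₀) ∈ spectrum ℂ (((Dg₂ rs zs).map Complex.ofReal)))) ∧
    -(π * (γ₂ * w ^ 2 - γ₂ * w ^ 2)) / w ^ 3 = 0 ∧
    deriv (fun b : ℝ => -(π * (b - γ₂ * w ^ 2)) / w ^ 3) (γ₂ * w ^ 2) = -(π / w ^ 3) ∧
    -(π / w ^ 3) < 0 := by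
  have hw' : w ≠ 0 := hw.ne'
  have hP : γ₁ * (w ^ 2 - 1) ≠ 0 := hγ.ne'
  have hg1 : γ₁ ≠ 0 := left_ne_zero_of_mul hP
  have hg3 : w ^ 2 - 1 ≠ 0 := right_ne_zero_of_mul hP
  have hk : 0 ≤ k₀ := by nlinarith [sq_nonneg (β₂ - γ₂ * w ^ 2)]
  have hr2 : rs ^ 2 * (γ₁ * (w ^ 2 - 1)) ^ 2 = 2 * k₀ := by
    rw [hrs, div_pow, mul_pow, sq_abs, Real.sq_sqrt hk, Real.sq_sqrt (by norm_num)]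
    field_simp
  have hz : 2 * (γ₁ * (w ^ 2 - 1)) * zs = w ^ 2 * (w ^ 2 * γ₂ - γ₁ * α₁ - β₂) := by
    rw [hzs]; field_simp
  have d11 : Dg₂ rs zs 0 0 = 0 := by
    have : HasDerivAt (fun r' => (g₂ r' zs).1) (1 * π * (2 * γ₁ * zs - w ^ 2 * γ₁ * α₁ - 2 * w ^ 2 * γ₁ * zs - w ^ 2 * β₂
          + w ^ 4 * γ₂) / w ^ 5) rs := by
      simp only [hg₂]
      exact (((hasDerivAt_id rs).mul_const π).mul_const _).div_const _
    simp only [hDg₂]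
    change deriv (fun r' => (g₂ r' zs).1) rs = 0
    rw [this.deriv]
    have : 2 * γ₁ * zs - w ^ 2 * γ₁ * α₁ - 2 * w ^ 2 * γ₁ * zs - w ^ 2 * β₂
          + w ^ 4 * γ₂ = 0 := by linear_combination -hz
    rw [this]; simp
  have d12 : Dg₂ rs zs 0 1 = -2 * (γ₁ * (w ^ 2 - 1)) * π * rs / w ^ 5 := by
    simp only [hDg₂]
    change deriv (fun z' => (g₂ rs z').1) zs = _
    have : (fun z' => (g₂ rs z').1) = fun z' => (-2 * (γ₁ * (w ^ 2 - 1)) * π * rs / w ^ 5) * z'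
        + rs * π * (- w ^ 2 * γ₁ * α₁ - w ^ 2 * β₂ + w ^ 4 * γ₂) / w ^ 5 := by
      funext z'; simp only [hg₂]; ring
    rw [this]
    exact (((hasDerivAt_id zs).const_mul _).add_const _).deriv.trans (mul_one _)
  have d21 : Dg₂ rs zs 1 0 = (γ₁ * (w ^ 2 - 1)) * π * rs / (2 * w) := by
    simp only [hDg₂]
    change deriv (fun r' => (g₂ r' zs).2) rs = _
    have : (fun r' => (g₂ r' zs).2) = fun r' => ((γ₁ * (w ^ 2 - 1)) * π / (4 * w)) * r' ^ 2
        + γ₁ * π * ((w ^ 2 - 1) * (8 * zs ^ 2) + 8 * w ^ 2 * α₁ * zs) / (4 * w ^ 5) := by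
      funext z'; simp only [hg₂]; field_simp; ring
    rw [this]
    refine (((hasDerivAt_pow 2 rs).const_mul _).add_const _).deriv.trans ?_
    norm_num; field_simp; ring
  have d22 : Dg₂ rs zs 1 1 = -2 * π * (β₂ - γ₂ * w ^ 2) / w ^ 3 := by
    simp only [hDg₂]
    change deriv (fun z' => (g₂ rs z').2) zs = _
    have : (fun z' => (g₂ rs z').2) = fun z' => (2 * (γ₁ * (w ^ 2 - 1)) * π / w ^ 5) * z' ^ 2
        + (2 * γ₁ * π * α₁ / w ^ 3) * z' + γ₁ * π * ((w ^ 2 - 1) * (rs ^ 2 * w ^ 4)) / (4 * w ^ 5) := by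
      funext z'; simp only [hg₂]; field_simp; ring
    rw [this]
    refine ((((hasDerivAt_pow 2 zs).const_mul _).add
      ((hasDerivAt_id zs).const_mul _)).add_const _).deriv.trans ?_
    norm_num
    have : 2 * (γ₁ * (w ^ 2 - 1)) * π / w ^ 5 * (2 * zs)
        = 2 * π / w ^ 5 * (2 * (γ₁ * (w ^ 2 - 1)) * zs) := by ring
    rw [this, hz]
    field_simp; ring
  have dq : Dg₂ rs zs 0 1 * Dg₂ rs zs 1 0 = -(2 * k₀ * π ^ 2 / w ^ 6) := by
    rw [d12, d21, ← hr2]; field_simp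
  have key := fhn_spec _ _ _ d11 d22 dq
  have hw3 : 0 < π / w ^ 3 := by positivity
  refine ⟨?_, ?_, by simp, ?_, by linarith⟩
  · have hs : 0 < 2 * k₀ - (β₂ - γ₂ * w ^ 2) ^ 2 := by linarith
    have hss := Real.sq_sqrt hs.le
    have hsp := Real.sqrt_pos.2 hs
    set s := Real.sqrt (2 * k₀ - (β₂ - γ₂ * w ^ 2) ^ 2)
    have him : 0 < π * s / w ^ 3 := by positivity
    refine ⟨⟨-(π * (β₂ - γ₂ * w ^ 2)) / w ^ 3, π * s / w ^ 3⟩, him.ne', key _ ?_, key _ ?_, rfl⟩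
    all_goals
      apply Complex.ext
      · simp only [pow_two, Complex.add_re, Complex.sub_re, Complex.mul_re, Complex.ofReal_re,
          Complex.ofReal_im, Complex.conj_re, Complex.conj_im, Complex.zero_re]
        field_simp
        linear_combination -π ^ 2 * hss
      · simp only [pow_two, Complex.add_im, Complex.sub_im, Complex.mul_im, Complex.ofReal_re,
          Complex.ofReal_im, Complex.conj_re, Complex.conj_im, Complex.zero_im]
        ring
  · intro hb
    have hww : w₀ ^ 2 = 2 * k₀ * π ^ 2 / w ^ 6 := by
      rw [hw₀, div_pow, mul_pow, mul_pow, sq_abs, Real.sq_sqrt (by norm_num), hk₀, hb]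
      field_simp; ring
    have hwc : (w₀ : ℂ) ^ 2 = ((2 * k₀ * π ^ 2 / w ^ 6 : ℝ) : ℂ) := by
      rw [← hww]; push_cast; rfl
    have ht : -2 * π * (β₂ - γ₂ * w ^ 2) / w ^ 3 = 0 := by rw [hb]; simp
    rw [ht] at key
    constructor <;> apply key <;> rw [← hwc] <;> push_cast <;>
      linear_combination (w₀ : ℂ) ^ 2 * Complex.I_sq
  · have : (fun b : ℝ => -(π * (b - γ₂ * w ^ 2)) / w ^ 3)
        = fun b => -(π / w ^ 3) * b + π * (γ₂ * w ^ 2) / w ^ 3 := by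
      funext b; ring
    rw [this]
    exact (((hasDerivAt_id _).const_mul _).add_const _).deriv.trans (mul_one _)
end
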